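/- arXiv:2401.01760 — 4 statements merged into one kernel-verified Lean document; each statement's English description precedes it below -/
import Mathlib

section
/- For every n ≥ 1 and every real number x: x · Σ_{i=1}^{n} C(n,i) A_i(x) d_{n−i}(x) = d_{n+1}(x). -/
open Finset

namespace SucEuler

/-- One-line notation word of a permutation: `word π i` is the value (in `1..n`)
at position `i ∈ {1,…,n}`, and `0` for positions outside `{1,…,n}`
(this implements the conventions `π(0)=π(n+1)=0`). -/
def word {n : ℕ} (π : Equiv.Perm (Fin n)) (i : ℕ) : ℕ :=
  if h : 1 ≤ i ∧ i ≤ n then ((π ⟨i - 1, by omega⟩ : Fin n) : ℕ) + 1 else 0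

/-- number of descents -/
def des {n : ℕ} (π : Equiv.Perm (Fin n)) : ℕ :=
  ((Finset.Icc 1 (n - 1)).filter fun i => word π (i + 1) < word π i).card

/-- number of ascents -/
def asc {n : ℕ} (π : Equiv.Perm (Fin n)) : ℕ :=
  ((Finset.Icc 1 (n - 1)).filter fun i => word π i < word π (i + 1)).card

/-- number of successions -/
def suc {n : ℕ} (π : Equiv.Perm (Fin n)) : ℕ :=
  ((Finset.Icc 1 (n - 1)).filter fun i => word π (i + 1) = word π i + 1).card

/-- number of big ascents -/
def basc {n : ℕ} (π : Equiv.Perm (Fin n)) : ℕ :=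
  ((Finset.Icc 1 (n - 1)).filter fun i => word π i + 2 ≤ word π (i + 1)).card

/-- number of excedances -/
def excStat {n : ℕ} (σ : Equiv.Perm (Fin n)) : ℕ :=
  (Finset.univ.filter fun i : Fin n => i < σ i).card

/-- number of fixed points -/
def fixStat {n : ℕ} (σ : Equiv.Perm (Fin n)) : ℕ :=
  (Finset.univ.filter fun i : Fin n => σ i = i).card

/-- number of drops -/
def dropStat {n : ℕ} (σ : Equiv.Perm (Fin n)) : ℕ :=
  (Finset.univ.filter fun i : Fin n => σ i < i).card

/-- number of excedances at positions `i ≥ 2` -/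
def excHat {n : ℕ} (σ : Equiv.Perm (Fin n)) : ℕ :=
  (Finset.univ.filter fun i : Fin n => 0 < (i : ℕ) ∧ i < σ i).card

/-- number of fixed points other than `1` -/
def fixHat {n : ℕ} (σ : Equiv.Perm (Fin n)) : ℕ :=
  (Finset.univ.filter fun i : Fin n => 0 < (i : ℕ) ∧ σ i = i).card

/-- number of cycles (orbits) of a permutation -/
def cyc {n : ℕ} (σ : Equiv.Perm (Fin n)) : ℕ :=
  σ.cycleType.card + fixStat σ

/-- number of cycle double ascents: values `x` with `σ⁻¹(x) < x < σ(x)` -/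
def cda {n : ℕ} (σ : Equiv.Perm (Fin n)) : ℕ :=
  (Finset.univ.filter fun x : Fin n => σ⁻¹ x < x ∧ x < σ x).card

open Classical in
/-- number of left-to-right minima -/
noncomputable def lrmin {n : ℕ} (π : Equiv.Perm (Fin n)) : ℕ :=
  ((Finset.Icc 1 n).filter fun i => ∀ j ∈ Finset.Icc 1 n, j < i → word π i < word π j).card

open Classical in
/-- number of proper left-to-right minima -/
noncomputable def plrmin {n : ℕ} (π : Equiv.Perm (Fin n)) : ℕ :=
  ((Finset.Icc 1 n).filter fun i =>
    (∀ j ∈ Finset.Icc 1 n, j < i → word π i < word π j) ∧ word π i ≠ 1 ∧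
      ∃ k ∈ Finset.Icc 1 n, i < k ∧ word π k = word π i - 1 ∧ word π (k + 1) < word π k).card

open Classical in
/-- number of simsun successions -/
noncomputable def simsuc {n : ℕ} (π : Equiv.Perm (Fin n)) : ℕ :=
  ((Finset.Icc 1 n).filter fun i =>
    ∃ j ∈ Finset.Icc 1 n, i < j ∧ word π j = word π i + 1 ∧
      ∀ k ∈ Finset.Icc 1 n, i < k → k < j → word π i + 1 < word π k).card

/-- number of peaks (with the boundary conventions `π(0)=π(n+1)=0`) -/
def pk {n : ℕ} (π : Equiv.Perm (Fin n)) : ℕ :=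
  ((Finset.Icc 1 n).filter fun i => word π (i - 1) < word π i ∧ word π (i + 1) < word π i).card

/-- number of valleys -/
def valStat {n : ℕ} (π : Equiv.Perm (Fin n)) : ℕ :=
  ((Finset.Icc 1 n).filter fun i => word π i < word π (i - 1) ∧ word π i < word π (i + 1)).card

/-- number of double ascents -/
def dasc {n : ℕ} (π : Equiv.Perm (Fin n)) : ℕ :=
  ((Finset.Icc 1 n).filter fun i => word π (i - 1) < word π i ∧ word π i < word π (i + 1)).card

/-- number of double descents -/
def ddes {n : ℕ} (π : Equiv.Perm (Fin n)) : ℕ :=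
  ((Finset.Icc 1 n).filter fun i => word π (i + 1) < word π i ∧ word π i < word π (i - 1)).card

open Classical in
/-- `nextVal σ m x` is the (0-indexed) first value `≤ m` (i.e. `< m` in 0-indexed terms)
in the forward orbit of `x` under `σ`: it equals `σ^t(x)` for the minimal `t ≥ 1`
with `σ^t(x) < m`, when such `t` exists. This is the action of the permutation `σ_k`
(with `m = n - k`) obtained by removing the `k` largest letters from the cycles of `σ`. -/
noncomputable def nextVal {n : ℕ} (σ : Equiv.Perm (Fin n)) (m : ℕ) (x : Fin n) : ℕ :=
  if h : ∃ t : ℕ, 0 < t ∧ (((σ ^ t) x : Fin n) : ℕ) < m then (((σ ^ Nat.find h) x : Fin n) : ℕ)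
  else 0

/-- `σ` is a simsun permutation of the second kind: for every `0 ≤ k ≤ n-1`, the
permutation of `[n-k]` obtained from `σ` by removing the `k` largest letters has
no cycle double ascents. (Here `m = n - k` and values are 0-indexed.) -/
def IsSimsun2 {n : ℕ} (σ : Equiv.Perm (Fin n)) : Prop :=
  ∀ m ≤ n, ∀ x : Fin n, (x : ℕ) < m →
    ¬ (nextVal σ⁻¹ m x < (x : ℕ) ∧ (x : ℕ) < nextVal σ m x)

noncomputable instance {n : ℕ} : DecidablePred (IsSimsun2 (n := n)) :=
  fun _ => Classical.propDecidable _

/-- the derangement polynomial `d_n(x)` -/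
def dpoly (n : ℕ) (x : ℝ) : ℝ :=
  ∑ σ ∈ Finset.univ.filter fun σ : Equiv.Perm (Fin n) => fixStat σ = 0, x ^ excStat σ

/-- the Eulerian polynomial `A_n(x)` -/
def eulerian (n : ℕ) (x : ℝ) : ℝ :=
  ∑ π : Equiv.Perm (Fin n), x ^ des π



open Polynomial in
theorem aux_sum_insert {n : ℕ} (S : Finset (Fin n)) :
    ∑ j : Fin n, (X : ℝ[X]) ^ (insert j S).card
      = (n : ℝ[X]) * X * X ^ S.card + X * (1 - X) * derivative (X ^ S.card) := by
  have h : ∀ j : Fin n, (X : ℝ[X]) ^ (insert j S).card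
      = X * X ^ S.card + (if j ∈ S then (1 - X) * X ^ S.card else 0) := by
    intro j
    by_cases hj : j ∈ S
    · simp [hj]; ring
    · simp [hj, pow_succ]; ring
  simp_rw [h]
  rw [Finset.sum_add_distrib, ← Finset.sum_filter]
  simp only [Finset.sum_const, Finset.card_univ, Fintype.card_fin, nsmul_eq_mul,
    derivative_X_pow, Finset.filter_univ_mem]
  rcases Nat.eq_zero_or_pos S.card with h0 | h0
  · simp [h0]
  · obtain ⟨m, hm⟩ := Nat.exists_eq_succ_of_ne_zero h0.ne'
    simp [hm, pow_succ]; ring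

open Polynomial in
theorem aux_sum_insert_erase {n : ℕ} (S F : Finset (Fin n)) (hd : Disjoint S F) (k : ℕ) :
    ∑ j : Fin n, (if (F.erase j).card = k then (X : ℝ[X]) ^ (insert j S).card else 0)
      = (if F.card = k then ((n : ℝ[X]) - (k : ℝ[X])) * X * X ^ S.card
          + X * (1 - X) * derivative (X ^ S.card) else 0)
        + (if F.card = k + 1 then ((k : ℝ[X]) + 1) * X * X ^ S.card else 0) := by
  have h : ∀ j : Fin n, (if (F.erase j).card = k then (X : ℝ[X]) ^ (insert j S).card else 0)
      = (if F.card = k then X ^ (insert j S).card else 0)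
        + (if j ∈ F then ((if F.card = k + 1 then X * X ^ S.card else 0)
            - (if F.card = k then X * X ^ S.card else 0)) else 0) := by
    intro j
    by_cases hj : j ∈ F
    · have hS : j ∉ S := fun h => Finset.disjoint_left.mp hd h hj
      have hc := Finset.card_erase_of_mem hj
      have hp : 0 < F.card := Finset.card_pos.mpr ⟨j, hj⟩
      have e1 : (F.erase j).card = k ↔ F.card = k + 1 := by omega
      simp only [e1, hj, if_true, Finset.card_insert_of_notMem hS, pow_succ]
      split_ifs <;> ring
    · simp [hj, Finset.erase_eq_of_notMem hj]
  simp_rw [h]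
  rw [Finset.sum_add_distrib, Finset.sum_ite_mem, Finset.univ_inter]
  simp only [Finset.sum_const, nsmul_eq_mul]
  by_cases h1 : F.card = k
  · have h2 : ¬ F.card = k + 1 := by omega
    simp only [h1, if_true, aux_sum_insert]
    simp; ring
  · by_cases h2 : F.card = k + 1
    · simp [h2]; ring
    · simp [h1, h2]

/-- insertion of a new minimum letter at position `p` -/
def insPerm {n : ℕ} (p : Fin (n + 1)) (e : Equiv.Perm (Fin n)) : Equiv.Perm (Fin (n + 1)) :=
  ((finSuccEquiv' p).trans (Equiv.optionCongr e)).trans (finSuccEquiv' 0).symm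

theorem insPerm_self {n : ℕ} (p : Fin (n + 1)) (e : Equiv.Perm (Fin n)) : insPerm p e p = 0 := by
  simp [insPerm]

theorem insPerm_succAbove {n : ℕ} (p : Fin (n + 1)) (e : Equiv.Perm (Fin n)) (i : Fin n) :
    insPerm p e (p.succAbove i) = (e i).succ := by
  simp [insPerm]

theorem insPerm_bij (n : ℕ) : Function.Bijective
    (fun q : Fin (n + 1) × Equiv.Perm (Fin n) => insPerm q.1 q.2) := by
  rw [Fintype.bijective_iff_injective_and_card]
  constructor
  · rintro ⟨p, e⟩ ⟨p', e'⟩ h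
    simp only at h
    have hp : p = p' := by
      apply (insPerm p e).injective
      rw [insPerm_self, h, insPerm_self]
    subst hp
    have : e = e' := by
      ext i
      have := congrArg (fun f => f (p.succAbove i)) h
      simp only [insPerm_succAbove] at this
      rw [Fin.succ_injective _ this]
    rw [this]
  · simp [Fintype.card_perm, Nat.factorial_succ]

def IsD {n : ℕ} (π : Equiv.Perm (Fin n)) (i : Fin n) : Prop :=
  ∃ h : (i : ℕ) + 1 < n, π ⟨i + 1, h⟩ < π i

instance {n : ℕ} (π : Equiv.Perm (Fin n)) : DecidablePred (IsD π) :=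
  fun _ => inferInstanceAs (Decidable (∃ _ , _))

def DS {n : ℕ} (π : Equiv.Perm (Fin n)) : Finset (Fin n) := Finset.univ.filter (IsD π)

theorem des_eq {n : ℕ} (π : Equiv.Perm (Fin n)) : des π = (DS π).card := by
  unfold des DS
  symm
  apply Finset.card_bij (fun (i : Fin n) _ => (i : ℕ) + 1)
  · rintro i hi
    simp only [Finset.mem_filter, Finset.mem_univ, true_and, Finset.mem_Icc] at hi ⊢
    obtain ⟨h, hi⟩ := hi
    refine ⟨by omega, ?_⟩
    have h1 : (i : ℕ) + 1 ≤ n := by omega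
    have h2 : (i : ℕ) + 1 + 1 ≤ n := by omega
    simp only [word, h1, h2]
    simpa using hi
  · intro i _ j _ h
    ext; omega
  · intro b hb
    simp only [Finset.mem_filter, Finset.mem_Icc] at hb
    obtain ⟨⟨h1, h2⟩, h3⟩ := hb
    obtain ⟨c, rfl⟩ : ∃ c, b = c + 1 := ⟨b - 1, by omega⟩
    refine ⟨⟨c, by omega⟩, ?_, rfl⟩
    simp only [Finset.mem_filter, Finset.mem_univ, true_and]
    refine ⟨by simp; omega, ?_⟩
    have h1 : c + 1 ≤ n := by omega
    have h2 : c + 1 + 1 ≤ n := by omega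
    simp only [word, h1, h2] at h3
    simpa using h3

theorem des_ins {n : ℕ} (p : Fin (n + 1)) (e : Equiv.Perm (Fin n)) :
    des (insPerm p e) = (Finset.univ.filter fun i => IsD (insPerm p e) (p.succAbove i)).card := by
  rw [des_eq, DS, Finset.card_filter, Fin.sum_univ_succAbove _ p, Finset.card_filter]
  have : ¬ IsD (insPerm p e) p := by
    rintro ⟨h, hh⟩
    rw [insPerm_self] at hh
    exact absurd hh (Fin.not_lt_zero _)
  simp [this]

theorem des_ins_zero {n : ℕ} (e : Equiv.Perm (Fin n)) : des (insPerm 0 e) = des e := by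
  rw [des_ins, des_eq, DS]
  congr 1
  ext i
  simp only [Finset.mem_filter, Finset.mem_univ, true_and, IsD, insPerm_succAbove]
  constructor
  · rintro ⟨h, hh⟩
    have h' : (i : ℕ) + 1 < n := by simpa using h
    refine ⟨h', ?_⟩
    have : (⟨((0 : Fin (n+1)).succAbove i : ℕ) + 1, h⟩ : Fin (n + 1))
        = (0 : Fin (n+1)).succAbove ⟨i + 1, h'⟩ := by ext; simp
    rw [this, insPerm_succAbove] at hh
    simpa using hh
  · rintro ⟨h, hh⟩
    have h' : ((0 : Fin (n+1)).succAbove i : ℕ) + 1 < n + 1 := by simpa using h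
    refine ⟨h', ?_⟩
    have : (⟨((0 : Fin (n+1)).succAbove i : ℕ) + 1, h'⟩ : Fin (n + 1))
        = (0 : Fin (n+1)).succAbove ⟨i + 1, h⟩ := by ext; simp
    rw [this, insPerm_succAbove]
    simpa using hh

theorem des_ins_succ {n : ℕ} (j : Fin n) (e : Equiv.Perm (Fin n)) :
    des (insPerm j.succ e) = (insert j (DS e)).card := by
  rw [des_ins, DS]
  congr 1
  ext i
  simp only [Finset.mem_filter, Finset.mem_univ, true_and, IsD, insPerm_succAbove,
    Finset.mem_insert]
  have hv : ∀ i : Fin n, ((j.succ.succAbove i : Fin (n+1)) : ℕ)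
      = if (i : ℕ) ≤ j then (i : ℕ) else i + 1 := by
    intro i
    simp only [Fin.succAbove, Fin.lt_def, Fin.val_castSucc, Fin.val_succ, Order.lt_add_one_iff]
    split_ifs <;> simp
  by_cases hij : i = j
  · subst hij
    simp only [true_or, iff_true]
    have h : ((i.succ.succAbove i : Fin (n+1)) : ℕ) + 1 < n + 1 := by
      rw [hv]; simp
    refine ⟨h, ?_⟩
    have : (⟨(i.succ.succAbove i : ℕ) + 1, h⟩ : Fin (n + 1)) = i.succ := by
      ext; simp [hv]
    rw [this, insPerm_self]
    exact Fin.succ_pos _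
  · simp only [hij, false_or]
    have hij' : (i : ℕ) ≠ j := fun h => hij (Fin.ext h)
    have key : ∀ (h : ((j.succ.succAbove i : Fin (n+1)) : ℕ) + 1 < n + 1) (h' : (i : ℕ) + 1 < n),
        (⟨(j.succ.succAbove i : ℕ) + 1, h⟩ : Fin (n + 1)) = j.succ.succAbove ⟨i + 1, h'⟩ := by
      intro h h'
      ext
      simp only [hv]
      split_ifs <;> omega
    constructor
    · rintro ⟨h, hh⟩
      have h' : (i : ℕ) + 1 < n := by
        rw [hv] at h
        have := j.2
        split_ifs at h <;> omega
      refine ⟨h', ?_⟩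
      rw [key h h', insPerm_succAbove] at hh
      simpa using hh
    · rintro ⟨h', hh⟩
      have h : ((j.succ.succAbove i : Fin (n+1)) : ℕ) + 1 < n + 1 := by
        rw [hv]
        split_ifs <;> omega
      refine ⟨h, ?_⟩
      rw [key h h', insPerm_succAbove]
      simpa using hh

open Polynomial in
noncomputable def AP (n : ℕ) : ℝ[X] := ∑ π : Equiv.Perm (Fin n), X ^ des π

open Polynomial in
theorem AP_succ (n : ℕ) :
    AP (n + 1) = (1 + (n : ℝ[X]) * (X : ℝ[X])) * AP n + X * (1 - X) * derivative (AP n) := by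
  unfold AP
  rw [← (insPerm_bij n).sum_comp (fun π => (X : ℝ[X]) ^ des π), Fintype.sum_prod_type_right,
    derivative_sum, Finset.mul_sum, Finset.mul_sum, ← Finset.sum_add_distrib]
  refine Finset.sum_congr rfl fun e _ => ?_
  simp only [Fin.sum_univ_succ, des_ins_zero, des_ins_succ, aux_sum_insert]
  rw [des_eq]
  ring

open Polynomial in
noncomputable def QP (n k : ℕ) : ℝ[X] :=
  ∑ σ : Equiv.Perm (Fin n), if fixStat σ = k then X ^ excStat σ else 0

def ES {n : ℕ} (σ : Equiv.Perm (Fin n)) : Finset (Fin n) := Finset.univ.filter fun i => i < σ i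
def FS {n : ℕ} (σ : Equiv.Perm (Fin n)) : Finset (Fin n) := Finset.univ.filter fun i => σ i = i

theorem dec_zero {n : ℕ} (e : Equiv.Perm (Fin n)) :
    excStat (Equiv.Perm.decomposeFin.symm (0, e)) = (ES e).card ∧
    fixStat (Equiv.Perm.decomposeFin.symm (0, e)) = (FS e).card + 1 := by
  constructor
  · simp [excStat, ES, Fin.card_filter_univ_succ]
  · simp [fixStat, FS, Fin.card_filter_univ_succ]

theorem dec_succ {n : ℕ} (e : Equiv.Perm (Fin n)) (i : Fin n) :
    excStat (Equiv.Perm.decomposeFin.symm ((e i).succ, e)) = (insert i (ES e)).card ∧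
    fixStat (Equiv.Perm.decomposeFin.symm ((e i).succ, e)) = ((FS e).erase i).card := by
  have hv : ∀ k : Fin n, Equiv.Perm.decomposeFin.symm ((e i).succ, e) k.succ
      = if k = i then 0 else (e k).succ := by
    intro k
    rw [Equiv.Perm.decomposeFin_symm_apply_succ]
    split_ifs with h
    · subst h; simp
    · rw [Equiv.swap_apply_of_ne_of_ne (Fin.succ_ne_zero _)]
      intro h'
      exact h (e.injective (Fin.succ_injective _ h'))
  constructor
  · rw [← Finset.insert_erase (Finset.mem_insert_self i (ES e)),
      Finset.card_insert_of_notMem (Finset.notMem_erase _ _)]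
    simp only [excStat, Fin.card_filter_univ_succ, hv, Equiv.Perm.decomposeFin_symm_apply_zero,
      Fin.succ_pos, if_true]
    congr 2
    ext k
    by_cases h : k = i <;> simp [h, ES]
  · simp only [fixStat, Fin.card_filter_univ_succ, hv, Equiv.Perm.decomposeFin_symm_apply_zero,
      Fin.succ_ne_zero, if_false]
    congr 1
    ext k
    by_cases h : k = i
    · simp [h, FS, (Fin.succ_ne_zero i).symm]
    · simp [h, FS]

open Polynomial in
theorem QP_aux (n k : ℕ) :
    QP (n + 1) k = (∑ σ : Equiv.Perm (Fin n), if fixStat σ + 1 = k then X ^ excStat σ else 0)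
      + (((n : ℝ[X]) - (k : ℝ[X])) * X * QP n k + X * (1 - X) * derivative (QP n k)
      + ((k : ℝ[X]) + 1) * X * QP n (k + 1)) := by
  unfold QP
  rw [← Equiv.sum_comp Equiv.Perm.decomposeFin.symm, Fintype.sum_prod_type_right,
    derivative_sum, Finset.mul_sum, Finset.mul_sum, Finset.mul_sum, ← Finset.sum_add_distrib,
    ← Finset.sum_add_distrib, ← Finset.sum_add_distrib]
  refine Finset.sum_congr rfl fun e _ => ?_
  rw [Fin.sum_univ_succ, ← Equiv.sum_comp e]
  simp only [dec_zero, dec_succ]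
  rw [aux_sum_insert_erase]
  · have h1 : excStat e = (ES e).card := rfl
    have h2 : fixStat e = (FS e).card := rfl
    rw [h1, h2]
    congr 1
    split_ifs <;> simp
  · rw [Finset.disjoint_left]
    intro a ha hb
    simp only [ES, FS, Finset.mem_filter, Finset.mem_univ, true_and] at ha hb
    exact absurd (hb ▸ ha) (lt_irrefl _)

open Polynomial in
theorem QP_succ_zero (n : ℕ) :
    QP (n + 1) 0 = (n : ℝ[X]) * X * QP n 0 + X * (1 - X) * derivative (QP n 0)
      + X * QP n 1 := by
  rw [QP_aux]; simp

open Polynomial in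
theorem QP_succ_succ (n k : ℕ) :
    QP (n + 1) (k + 1) = QP n k + (((n : ℝ[X]) - ((k : ℝ[X]) + 1)) * X * QP n (k + 1)
      + X * (1 - X) * derivative (QP n (k + 1)) + ((k : ℝ[X]) + 2) * X * QP n (k + 2)) := by
  rw [QP_aux]
  simp only [add_left_inj]
  push_cast
  rw [← QP]
  ring

open Polynomial in
theorem QP_choose (n : ℕ) : ∀ k, QP n k = (n.choose k : ℝ[X]) * QP (n - k) 0 := by
  induction n using Nat.strong_induction_on with
  | _ n ih =>
    intro k
    rcases k with _ | k
    · simp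
    rcases n with _ | n
    · simp [QP, fixStat]
    rw [QP_succ_succ, ih n (by omega) k, ih n (by omega) (k+1), ih n (by omega) (k+2)]
    rcases lt_trichotomy n k with h | h | h
    · simp [Nat.choose_eq_zero_of_lt h, Nat.choose_eq_zero_of_lt (show n < k + 1 by omega),
        Nat.choose_eq_zero_of_lt (show n < k + 2 by omega), Nat.choose_eq_zero_of_lt (show n + 1 < k + 1 by omega)]
    · subst h
      simp [Nat.choose_eq_zero_of_lt (show n < n + 2 by omega)]
    · obtain ⟨m, rfl⟩ : ∃ m, n = m + (k + 1) := ⟨n - (k + 1), by omega⟩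
      have e1 : m + (k + 1) - k = m + 1 := by omega
      have e2 : m + (k + 1) - (k + 1) = m := by omega
      have e3 : m + (k + 1) - (k + 2) = m - 1 := by omega
      have e4 : m + (k + 1) + 1 - (k + 1) = m + 1 := by omega
      rw [e1, e2, e3, e4, Nat.choose_succ_succ]
      have hr := QP_succ_zero m
      rw [ih m (by omega) 1] at hr
      have hc := Nat.choose_succ_right_eq (m + (k + 1)) (k + 1)
      rw [e2] at hc
      have hc' : ((m + (k + 1)).choose (k + 2) : ℝ[X]) * (k + 2)
          = ((m + (k + 1)).choose (k + 1) : ℝ[X]) * m := by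
        have := congrArg (Nat.cast : ℕ → ℝ[X]) hc
        push_cast at this
        rw [← this]; ring
      simp only [Nat.choose_one_right] at hr
      simp only [derivative_mul, derivative_natCast, zero_mul, zero_add, Nat.succ_eq_add_one]
      push_cast
      linear_combination (X * QP (m - 1) 0) * hc'
        - ((m + (k + 1)).choose (k + 1) : ℝ[X]) * hr

open Polynomial in
theorem DP_succ (n : ℕ) :
    QP (n + 1) 0 = (n : ℝ[X]) * X * QP n 0 + X * (1 - X) * derivative (QP n 0)
      + (n : ℝ[X]) * X * QP (n - 1) 0 := by
  rw [QP_succ_zero, QP_choose n 1]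
  simp; ring

open Polynomial in
noncomputable def aP (n : ℕ) : ℝ[X] := if n = 0 then 0 else AP n

open Polynomial in
theorem aP_succ (n : ℕ) :
    aP (n + 1) = (1 + (n : ℝ[X]) * (X : ℝ[X])) * aP n + X * (1 - X) * derivative (aP n)
      + (if n = 0 then 1 else 0) := by
  rcases n with _ | n
  · simp [aP, AP_succ]
    simp [AP, des]
  · simp [aP]
    rw [AP_succ]; push_cast; rfl

open Polynomial in
noncomputable def SP (n : ℕ) : ℝ[X] :=
  ∑ i ∈ Finset.range (n + 1), (n.choose i : ℝ[X]) * (aP i * QP (n - i) 0)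

open Polynomial in
theorem SP_low (n : ℕ) : ∑ i ∈ Finset.range (n + 1),
    (n.choose i : ℝ[X]) * (((n - i : ℕ) : ℝ[X]) * (aP i * QP (n - i - 1) 0))
      = (n : ℝ[X]) * SP (n - 1) := by
  rcases n with _ | n
  · simp
  rw [Finset.sum_range_succ]
  simp only [Nat.sub_self, Nat.cast_zero, zero_mul, mul_zero, add_zero]
  rw [SP, Nat.add_sub_cancel, Finset.mul_sum]
  refine Finset.sum_congr rfl fun i hi => ?_
  have e : n + 1 - i - 1 = n - i := by omega
  rw [e]
  have := congrArg (Nat.cast : ℕ → ℝ[X]) (Nat.choose_mul_succ_eq n i)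
  simp only [Nat.cast_mul] at this
  linear_combination (-(aP i * QP (n - i) 0)) * this

open Polynomial in
theorem SP_succ (n : ℕ) :
    SP (n + 1) = (1 + (n : ℝ[X]) * (X : ℝ[X])) * SP n + X * (1 - X) * derivative (SP n)
      + (n : ℝ[X]) * X * SP (n - 1) + QP n 0 := by
  have h0 : QP n 0 = ∑ i ∈ Finset.range (n + 1),
      (n.choose i : ℝ[X]) * ((if i = 0 then 1 else 0) * QP (n - i) 0) := by
    simp
  have h1 : (n : ℝ[X]) * X * SP (n - 1) = X * ((n : ℝ[X]) * SP (n - 1)) := by ring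
  rw [h1, ← SP_low, h0, SP, SP,
    Finset.sum_choose_succ_mul (fun i j => aP i * QP j 0)]
  rw [derivative_sum]
  simp only [Finset.mul_sum, ← Finset.sum_add_distrib]
  refine Finset.sum_congr rfl fun i hi => ?_
  have hi' : i ≤ n := by simpa [Nat.lt_succ_iff] using hi
  have e : n + 1 - i = (n - i) + 1 := by omega
  rw [e, aP_succ, DP_succ]
  simp only [derivative_mul, derivative_natCast, zero_mul, zero_add]
  have : (n : ℝ[X]) = i + ((n - i : ℕ) : ℝ[X]) := by
    rw [← Nat.cast_add]; congr 1; omega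
  rw [this]
  ring

open Polynomial in
theorem main_poly (n : ℕ) : X * SP n = QP (n + 1) 0 := by
  induction n using Nat.strong_induction_on with
  | _ n ih =>
    rcases n with _ | n
    · rw [DP_succ]
      simp [SP, aP, QP, excStat]
    · rw [DP_succ, ← ih n (by omega), SP_succ]
      have hl : (n : ℝ[X]) * (X * SP (n - 1)) = (n : ℝ[X]) * QP n 0 := by
        rcases n with _ | n
        · simp
        · rw [Nat.add_sub_cancel, ih n (by omega)]
      simp only [derivative_mul, derivative_X, Nat.add_sub_cancel]
      push_cast
      linear_combination X * hl

theorem eval_QP (n : ℕ) (x : ℝ) : (QP n 0).eval x = dpoly n x := by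
  rw [QP, dpoly, Finset.sum_filter, Polynomial.eval_finsetSum]
  refine Finset.sum_congr rfl fun σ _ => ?_
  split_ifs <;> simp

theorem eval_AP (n : ℕ) (x : ℝ) : (AP n).eval x = eulerian n x := by
  simp [AP, eulerian, Polynomial.eval_finsetSum]

/-- `x · Σ_{i=1}^n C(n,i) A_i(x) d_{n-i}(x) = d_{n+1}(x)`. -/
theorem statement7 (n : ℕ) (hn : 1 ≤ n) (x : ℝ) :
    x * ∑ i ∈ Finset.Icc 1 n, (n.choose i : ℝ) * eulerian i x * dpoly (n - i) x =
      dpoly (n + 1) x := by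
  rw [← eval_QP, ← main_poly, Polynomial.eval_mul, Polynomial.eval_X, SP,
    Polynomial.eval_finsetSum, Finset.range_eq_Ico, Finset.sum_eq_sum_Ico_succ_bot (by omega)]
  simp only [aP, if_true, zero_mul, mul_zero, Polynomial.eval_zero, zero_add]
  congr 1
  have : Finset.Icc 1 n = Finset.Ico 1 (n + 1) := by ext; simp
  rw [this]
  refine Finset.sum_congr rfl fun i hi => ?_
  have hi0 : i ≠ 0 := by
    have := (Finset.mem_Ico.mp hi).1
    omega
  simp [hi0, eval_QP, eval_AP, mul_assoc]

end SucEuler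
end

section
/- For every n ≥ 1 and every real number x: Σ_{π ∈ S_n, suc(π)=0} x^{asc(π)+1} = d_n(x) + x·d_{n−1}(x). -/
open Finset

namespace SucEuler

def Tt (n : ℕ) (φ : ℕ → ℕ → ℝ) (e f : ℕ) : ℝ :=
  φ e (f+1) + e * φ e f + f * φ (e+1) (f-1) + ((n:ℝ) - e - f) * φ (e+1) f

def Dd (φ : ℕ → ℕ → ℝ) (e f : ℕ) : ℝ := φ (e+1) f - φ e (f+1)

def Ii (n : ℕ) (φ : ℕ → ℕ → ℝ) : ℝ := ∑ σ : Equiv.Perm (Fin n), φ (excStat σ) (fixStat σ)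

def Jj (n : ℕ) (φ : ℕ → ℕ → ℝ) : ℝ := ∑ σ : Equiv.Perm (Fin n), φ (basc σ + 1) (suc σ)

lemma Dd_Tt (n : ℕ) (φ : ℕ → ℕ → ℝ) : Dd (Tt (n+1) φ) = Tt n (Dd φ) := by
  funext e f
  rcases f with _ | f
  · simp only [Dd, Tt]; push_cast; ring
  · simp only [Dd, Tt, Nat.add_sub_cancel]; push_cast; ring

lemma exc_sum {n : ℕ} (σ : Equiv.Perm (Fin n)) :
    excStat σ = ∑ i, if i < σ i then 1 else 0 := by
  rw [excStat, Finset.card_filter]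

lemma fix_sum {n : ℕ} (σ : Equiv.Perm (Fin n)) :
    fixStat σ = ∑ i, if σ i = i then 1 else 0 := by
  rw [fixStat, Finset.card_filter]

lemma dec_succ_s8 {n : ℕ} (e : Equiv.Perm (Fin n)) (i k : Fin n) :
    Equiv.Perm.decomposeFin.symm ((e i).succ, e) k.succ = if k = i then 0 else (e k).succ := by
  rw [Equiv.Perm.decomposeFin_symm_apply_succ]
  split_ifs with h
  · subst h; simp
  · rw [Equiv.swap_apply_of_ne_of_ne]
    · exact Fin.succ_ne_zero _
    · simpa using h

lemma exc_zero {n : ℕ} (e : Equiv.Perm (Fin n)) :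
    excStat (Equiv.Perm.decomposeFin.symm (0, e)) = excStat e := by
  rw [exc_sum, exc_sum, Fin.sum_univ_succ]
  simp [-Finset.sum_boole]

lemma fix_zero {n : ℕ} (e : Equiv.Perm (Fin n)) :
    fixStat (Equiv.Perm.decomposeFin.symm (0, e)) = fixStat e + 1 := by
  rw [fix_sum, fix_sum, Fin.sum_univ_succ]
  simp [-Finset.sum_boole, add_comm]

lemma exc_succ {n : ℕ} (e : Equiv.Perm (Fin n)) (i : Fin n) :
    excStat (Equiv.Perm.decomposeFin.symm ((e i).succ, e)) + (if i < e i then 1 else 0)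
      = excStat e + 1 := by
  rw [exc_sum, exc_sum, Fin.sum_univ_succ]
  simp only [dec_succ_s8, Equiv.Perm.decomposeFin_symm_apply_zero, Fin.succ_pos, if_true]
  have : (if i < e i then 1 else 0) = ∑ k, if k = i then (if i < e i then 1 else 0) else 0 := by
    simp
  rw [this, add_assoc, ← Finset.sum_add_distrib, add_comm]
  congr 1
  apply Finset.sum_congr rfl
  intro k _
  by_cases h : k = i
  · subst h; simp
  · simp [h]

lemma fix_succ {n : ℕ} (e : Equiv.Perm (Fin n)) (i : Fin n) :
    fixStat (Equiv.Perm.decomposeFin.symm ((e i).succ, e)) + (if e i = i then 1 else 0)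
      = fixStat e := by
  rw [fix_sum, fix_sum, Fin.sum_univ_succ]
  simp only [dec_succ_s8, Equiv.Perm.decomposeFin_symm_apply_zero, Fin.succ_ne_zero, if_false]
  have : (if e i = i then 1 else 0) = ∑ k, if k = i then (if e i = i then 1 else 0) else 0 := by
    simp
  rw [this, add_assoc, ← Finset.sum_add_distrib, zero_add]
  apply Finset.sum_congr rfl
  intro k _
  by_cases h : k = i
  · subst h; simp [(Fin.succ_ne_zero _).symm]
  · simp [h]

lemma I_rec (n : ℕ) (φ : ℕ → ℕ → ℝ) : Ii (n+1) φ = Ii n (Tt n φ) := by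
  unfold Ii
  rw [← Equiv.sum_comp Equiv.Perm.decomposeFin.symm, Fintype.sum_prod_type_right]
  apply Finset.sum_congr rfl
  intro e _
  rw [Fin.sum_univ_succ, exc_zero, fix_zero, ← Equiv.sum_comp e]
  have key : ∀ i : Fin n,
      φ (excStat (Equiv.Perm.decomposeFin.symm ((e i).succ, e)))
        (fixStat (Equiv.Perm.decomposeFin.symm ((e i).succ, e))) =
      (((if i < e i then 1 else 0 : ℕ)) : ℝ) * φ (excStat e) (fixStat e)
      + (((if e i = i then 1 else 0 : ℕ)) : ℝ) * φ (excStat e + 1) (fixStat e - 1)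
      + (1 - (((if i < e i then 1 else 0 : ℕ)) : ℝ) - (((if e i = i then 1 else 0 : ℕ)) : ℝ))
        * φ (excStat e + 1) (fixStat e) := by
    intro i
    have h1 := exc_succ e i
    have h2 := fix_succ e i
    by_cases ha : i < e i
    · have hb : ¬ e i = i := ne_of_gt ha
      simp only [ha, hb, if_true, if_false, add_zero] at h1 h2 ⊢
      rw [h2, Nat.add_right_cancel h1]; simp
    · by_cases hb : e i = i
      · rw [if_neg ha, add_zero] at h1
        rw [if_pos hb] at h2
        rw [if_neg ha, if_pos hb, h1, ← h2]; simp
      · simp only [ha, hb, if_false, add_zero] at h1 h2 ⊢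
        rw [h1, h2]; simp
  rw [Finset.sum_congr rfl (fun i _ => key i)]
  simp only [Finset.sum_add_distrib, ← Finset.sum_mul, Finset.sum_sub_distrib, ← Nat.cast_sum]
  rw [← exc_sum, ← fix_sum]
  simp [Tt]; ring

/-- indicator of a big ascent -/
def gB (a b : ℕ) : ℕ := if 1 ≤ a ∧ a + 2 ≤ b then 1 else 0
/-- indicator of a succession -/
def gS (a b : ℕ) : ℕ := if 1 ≤ a ∧ b = a + 1 then 1 else 0

lemma word_zero {n : ℕ} (π : Equiv.Perm (Fin n)) : word π 0 = 0 := by simp [word]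
lemma word_big {n : ℕ} (π : Equiv.Perm (Fin n)) : word π (n+1) = 0 := by simp [word]
lemma word_pos {n : ℕ} (π : Equiv.Perm (Fin n)) (i : ℕ) (h : 1 ≤ i) (h' : i ≤ n) :
    1 ≤ word π i := by simp [word, h, h']
lemma word_le {n : ℕ} (π : Equiv.Perm (Fin n)) (i : ℕ) : word π i ≤ n := by
  unfold word; split_ifs
  · exact (π _).2
  · omega

lemma cnt_sum {n : ℕ} (π : Equiv.Perm (Fin n)) (P : ℕ → ℕ → Prop) [∀ a b, Decidable (P a b)]
    (hP : ∀ a, 1 ≤ a → ¬ P a 0) :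
    ((Finset.Icc 1 (n - 1)).filter fun i => P (word π i) (word π (i + 1))).card
      = ∑ i ∈ range (n+1), if 1 ≤ word π i ∧ P (word π i) (word π (i+1)) then 1 else 0 := by
  rw [← Finset.card_filter]
  congr 1
  ext i
  simp only [Finset.mem_filter, Finset.mem_Icc, Finset.mem_range]
  constructor
  · rintro ⟨⟨h1, h2⟩, h3⟩
    exact ⟨by omega, word_pos π i h1 (by omega), h3⟩
  · rintro ⟨h1, h2, h3⟩
    have hi : i ≠ 0 := by rintro rfl; simp [word_zero] at h2
    have hn : i ≠ n := by
      rintro rfl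
      rw [word_big] at h3
      exact hP _ h2 h3
    exact ⟨⟨by omega, by omega⟩, h3⟩

lemma basc_sum {n : ℕ} (π : Equiv.Perm (Fin n)) :
    basc π = ∑ i ∈ range (n+1), gB (word π i) (word π (i+1)) :=
  cnt_sum π (fun a b => a + 2 ≤ b) (by intros; omega)

lemma suc_sum {n : ℕ} (π : Equiv.Perm (Fin n)) :
    suc π = ∑ i ∈ range (n+1), gS (word π i) (word π (i+1)) :=
  cnt_sum π (fun a b => b = a + 1) (by intros; omega)

/-- insert the largest letter at position `k` -/
def ins {n : ℕ} (p : Fin (n+1) × Equiv.Perm (Fin n)) : Equiv.Perm (Fin (n+1)) :=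
  ((finSuccEquiv' p.1).trans (Equiv.optionCongr p.2)).trans (finSuccEquiv' (Fin.last n)).symm

lemma ins_self {n : ℕ} (k : Fin (n+1)) (π : Equiv.Perm (Fin n)) :
    ins (k, π) k = Fin.last n := by simp [ins]

lemma ins_succAbove {n : ℕ} (k : Fin (n+1)) (π : Equiv.Perm (Fin n)) (i : Fin n) :
    ins (k, π) (k.succAbove i) = (π i).castSucc := by simp [ins]

lemma ins_bij (n : ℕ) : Function.Bijective (ins (n := n)) := by
  rw [Fintype.bijective_iff_injective_and_card]
  constructor
  · rintro ⟨k, π⟩ ⟨l, ρ⟩ h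
    have hk : k = l := by
      apply (ins (l, ρ)).injective
      rw [← h, ins_self, h, ins_self]
    subst hk
    congr 1
    ext i
    have := congrArg (fun f => (f (k.succAbove i) : Fin (n+1))) h
    simp only [ins_succAbove] at this
    rw [Fin.castSucc_injective _ this]
  · simp [Fintype.card_perm, Nat.factorial_succ]

lemma word_ins {n : ℕ} (k : Fin (n+1)) (π : Equiv.Perm (Fin n)) (i : ℕ) :
    word (ins (k, π)) i = if i ≤ k then word π i else if i = k + 1 then n + 1
      else word π (i - 1) := by
  obtain ⟨k, hk⟩ := k
  simp only
  rcases i with _ | i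
  · simp [word_zero]
  split_ifs with h1 h2
  · have e : (⟨i, by omega⟩ : Fin (n+1)) = Fin.succAbove ⟨k, hk⟩ ⟨i, by omega⟩ := by
      rw [Fin.succAbove_of_castSucc_lt]
      · rfl
      · simp [Fin.lt_def]; omega
    have a1 : i ≤ n := by omega
    have a2 : i + 1 ≤ n := by omega
    simp only [word, Nat.add_sub_cancel, e, ins_succAbove]
    simp [a1, a2]
  · obtain rfl : i = k := by omega
    have a1 : i ≤ n := by omega
    simp only [word, Nat.add_sub_cancel, ins_self]
    simp [a1]
  · by_cases a1 : i ≤ n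
    · obtain ⟨i, rfl⟩ : ∃ j, i = j + 1 := ⟨i - 1, by omega⟩
      have e : (⟨i+1, by omega⟩ : Fin (n+1)) = Fin.succAbove ⟨k, hk⟩ ⟨i, by omega⟩ := by
        rw [Fin.succAbove_of_le_castSucc]
        · rfl
        · simp [Fin.le_def]; omega
      simp only [word, Nat.add_sub_cancel, e, ins_succAbove]
      simp [a1]
    · have : ¬ i ≤ n := a1
      simp [word, this]

lemma ins_sum (g : ℕ → ℕ → ℕ) (w w' : ℕ → ℕ) (k N : ℕ)
    (h : ∀ i, w' i = if i ≤ k then w i else if i = k + 1 then N else w (i-1)) (m : ℕ) :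
    ∑ i ∈ range (k + m + 2), g (w' i) (w' (i+1)) + g (w k) (w (k+1)) =
      ∑ i ∈ range (k + m + 1), g (w i) (w (i+1)) + g (w k) N + g N (w (k+1)) := by
  induction m with
  | zero =>
    simp only [add_zero]
    rw [Finset.sum_range_succ, Finset.sum_range_succ, Finset.sum_range_succ]
    have : ∑ i ∈ range k, g (w' i) (w' (i+1)) = ∑ i ∈ range k, g (w i) (w (i+1)) := by
      apply Finset.sum_congr rfl
      intro i hi
      rw [Finset.mem_range] at hi
      rw [h, h, if_pos (by omega), if_pos (by omega)]
    rw [this, h k, h (k+1), h (k+1+1)]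
    simp
    ring
  | succ m ih =>
    rw [show k + (m+1) + 2 = (k + m + 2) + 1 by ring, Finset.sum_range_succ,
      show k + (m+1) + 1 = (k + m + 1) + 1 by ring, 
      Finset.sum_range_succ (fun i => g (w i) (w (i+1))) (k+m+1)]
    have : g (w' (k+m+2)) (w' (k+m+2+1)) = g (w (k+m+1)) (w (k+m+1+1)) := by
      rw [h, h, if_neg (by omega), if_neg (by omega), if_neg (by omega), if_neg (by omega)]
      rfl
    rw [this]
    omega

lemma word_count_zero {n : ℕ} (π : Equiv.Perm (Fin n)) :
    ∑ i ∈ range (n+1), (if word π i = 0 then 1 else 0) = 1 := by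
  rw [Finset.sum_eq_single 0]
  · simp [word_zero]
  · intro i hi h0
    rw [Finset.mem_range] at hi
    have := word_pos π i (by omega) (by omega)
    rw [if_neg (by omega)]
  · simp

lemma word_count_top {n : ℕ} (hn : 1 ≤ n) (π : Equiv.Perm (Fin n)) :
    ∑ i ∈ range (n+1), (if word π i = n then 1 else 0) = 1 := by
  obtain ⟨n, rfl⟩ : ∃ m, n = m + 1 := ⟨n - 1, by omega⟩
  rw [Finset.sum_range_succ', Finset.sum_range, word_zero, if_neg (by omega), add_zero]
  have : ∀ i : Fin (n+1), (if word π (i+1) = n+1 then 1 else 0) =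
      if i = π.symm (Fin.last n) then 1 else 0 := by
    intro i
    have h1 : (i:ℕ) ≤ n := by omega
    congr 1
    rw [Equiv.eq_symm_apply, Fin.ext_iff]
    simp [word, h1]
  rw [Finset.sum_congr rfl (fun i _ => this i)]
  simp

lemma J_rec (n : ℕ) (hn : 1 ≤ n) (φ : ℕ → ℕ → ℝ) : Jj (n+1) φ = Jj n (Tt n φ) := by
  unfold Jj
  rw [← Equiv.sum_comp (Equiv.ofBijective _ (ins_bij n)), Fintype.sum_prod_type_right]
  apply Finset.sum_congr rfl
  intro π _
  simp only [Equiv.ofBijective_apply]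
  obtain ⟨F, hF⟩ : ∃ F : ℕ → ℝ, F =
      (fun j : ℕ =>
      ((if word π j = 0 then 1 else 0 : ℕ) : ℝ) * φ (basc π + 1) (suc π)
      + ((if word π j = n then 1 else 0 : ℕ) : ℝ) * φ (basc π + 1) (suc π + 1)
      + (gB (word π j) (word π (j+1)) : ℝ) * φ (basc π + 1) (suc π)
      + (gS (word π j) (word π (j+1)) : ℝ) * φ (basc π + 2) (suc π - 1)
      + (1 - ((if word π j = 0 then 1 else 0 : ℕ) : ℝ) - ((if word π j = n then 1 else 0 : ℕ) : ℝ)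
          - (gB (word π j) (word π (j+1)) : ℝ) - (gS (word π j) (word π (j+1)) : ℝ))
        * φ (basc π + 2) (suc π)) := ⟨_, rfl⟩
  have key : ∀ k : Fin (n+1),
      φ (basc (ins (k, π)) + 1) (suc (ins (k, π))) =
      F k := by
    intro k
    have hB := ins_sum gB (word π) (word (ins (k, π))) k (n+1) (word_ins k π) (n - k)
    have hS := ins_sum gS (word π) (word (ins (k, π))) k (n+1) (word_ins k π) (n - k)
    have hk : (k:ℕ) + (n - k) = n := by omega
    rw [hk] at hB hS
    rw [← basc_sum π, ← basc_sum (ins (k, π))] at hB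
    rw [← suc_sum π, ← suc_sum (ins (k, π))] at hS
    rw [hF]
    beta_reduce
    have l1 := word_le π k
    have l2 := word_le π (k+1)
    generalize word π k = a at *
    generalize word π (k+1) = b at *
    generalize basc (ins (k, π)) = B' at *
    generalize suc (ins (k, π)) = S' at *
    generalize basc π = B at *
    generalize suc π = S at *
    have z1 : gB (n+1) b = 0 := by unfold gB; rw [if_neg (by omega)]
    have z2 : gS (n+1) b = 0 := by unfold gS; rw [if_neg (by omega)]
    rw [z1] at hB
    rw [z2] at hS
    unfold gB at *
    unfold gS at *
    by_cases c0 : a = 0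
    · subst c0
      have : ¬ (0 = n) := by omega
      simp [this] at hB hS ⊢
      rw [hB, hS]
    by_cases c1 : a = n
    · subst c1
      have h1 : ¬ (a + 2 ≤ b) := by omega
      have h2 : ¬ (b = a + 1) := by omega
      simp [c0, h1, h2] at hB hS ⊢
      rw [hB, hS, if_pos (by omega)]
    have e1 : 1 ≤ a := by omega
    have e2 : a + 2 ≤ n + 1 := by omega
    have e3 : ¬ (n = a) := by omega
    by_cases c2 : a + 2 ≤ b
    · have h2 : ¬ (b = a + 1) := by omega
      rw [if_pos ⟨e1, c2⟩, if_pos ⟨e1, e2⟩] at hB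
      rw [if_neg (by omega), if_neg (by omega)] at hS
      rw [show B' = B by omega, show S' = S by omega]
      simp [c0, c1, c2, h2, e1]
    by_cases c3 : b = a + 1
    · rw [if_neg (by omega), if_pos ⟨e1, e2⟩] at hB
      rw [if_pos ⟨e1, c3⟩, if_neg (by omega)] at hS
      rw [show B' = B + 1 by omega, show S' = S - 1 by omega]
      simp [c0, c1, c3, e1]
    · rw [if_neg (by omega), if_pos ⟨e1, e2⟩] at hB
      rw [if_neg (by omega), if_neg (by omega)] at hS
      rw [show B' = B + 1 by omega, show S' = S by omega]
      simp [c0, c1, c2, c3]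
  rw [Finset.sum_congr rfl (fun k _ => key k), Fin.sum_univ_eq_sum_range, hF]
  simp only [Finset.sum_add_distrib, ← Finset.sum_mul, Finset.sum_sub_distrib, ← Nat.cast_sum]
  rw [← basc_sum, ← suc_sum, word_count_zero, word_count_top hn]
  simp [Tt]; ring

lemma J_eq (n : ℕ) : ∀ φ, Jj (n+1) φ = Ii (n+1) φ + Ii n (Dd φ) := by
  induction n with
  | zero =>
    intro φ
    simp [Jj, Ii, Dd, basc, suc, excStat, fixStat]
  | succ n ih =>
    intro φ
    rw [J_rec _ (by omega), ih, ← I_rec, Dd_Tt, ← I_rec]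

lemma asc_eq {n : ℕ} (π : Equiv.Perm (Fin n)) (h : suc π = 0) : asc π = basc π := by
  unfold suc at h
  rw [Finset.card_eq_zero, Finset.filter_eq_empty_iff] at h
  unfold asc basc
  congr 1
  apply Finset.filter_congr
  intro i hi
  have := h hi
  omega

/-- `Σ_{π ∈ S_n, suc(π)=0} x^(asc(π)+1) = d_n(x) + x·d_{n-1}(x)`. -/
theorem statement8 (n : ℕ) (hn : 1 ≤ n) (x : ℝ) :
    ∑ π ∈ Finset.univ.filter fun π : Equiv.Perm (Fin n) => suc π = 0, x ^ (asc π + 1) =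
      dpoly n x + x * dpoly (n - 1) x := by
  obtain ⟨n, rfl⟩ : ∃ m, n = m + 1 := ⟨n - 1, by omega⟩
  have h := J_eq n (fun e f => if f = 0 then x ^ e else 0)
  unfold Jj Ii Dd at h
  simp only [dpoly, Finset.sum_filter, Nat.add_sub_cancel, Finset.mul_sum]
  convert h using 2
  · split_ifs with h0
    · simp [asc_eq _ h0, h0]
    · simp [h0]
  · apply Finset.sum_congr rfl
    intro σ _
    simp [pow_succ']

end SucEuler
end

section
/- For every n ≥ 0 and all real numbers x, y, s: Σ_{π ∈ S_{n+1}} x^{basc(π)} y^{des(π)} s^{suc(π)} = Σ_{i=0}^{n} C(n,i) · (Σ_{σ ∈ S_i} x^{exc(σ)} y^{drop(σ)+fix(σ)}) · (Σ_{τ ∈ S_{n−i}} x^{exc(τ)} y^{drop(τ)} s^{fix(τ)}). -/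
open Finset

namespace SucEuler

section Aux

variable {R : Type*} [CommRing R]

theorem deriv_prod {ι : Type*} [DecidableEq ι] (d : Derivation ℤ R R) (q : R) (t : Finset ι)
    (f : ι → R) (h : ∀ i ∈ t, d (f i) = q) :
    d (∏ i ∈ t, f i) = ∑ i ∈ t, (∏ j ∈ t.erase i, f j) * q := by
  induction t using Finset.induction_on with
  | empty => simp
  | insert a t ha ih =>
    rw [Finset.prod_insert ha, Derivation.leibniz, ih fun i hi => h i (mem_insert_of_mem hi),
      h a (mem_insert_self _ _), Finset.sum_insert ha, Finset.erase_insert ha,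
      smul_eq_mul, smul_eq_mul, Finset.mul_sum, add_comm]
    congr 1
    refine Finset.sum_congr rfl fun i hi => ?_
    have hne : a ≠ i := fun h => ha (h ▸ hi)
    rw [Finset.erase_insert_of_ne hne, Finset.prod_insert (by simp [ha]), mul_assoc]

def wt (x y s : R) (i j : ℕ) : R := if i < j then x else if j < i then y else s

def Dp (n : ℕ) (x y s : R) : R := ∑ σ : Equiv.Perm (Fin n), ∏ i : Fin n, wt x y s i (σ i)

theorem wt_succ (x y s : R) (i j : ℕ) : wt x y s (i + 1) (j + 1) = wt x y s i j := by
  simp [wt]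

theorem Dp_succ (d : Derivation ℤ R R) (x y s : R) (hx : d x = x * y) (hy : d y = x * y)
    (hs : d s = x * y) (n : ℕ) : Dp (n + 1) x y s = s * Dp n x y s + d (Dp n x y s) := by
  unfold Dp
  rw [← Equiv.sum_comp Equiv.Perm.decomposeFin.symm, Fintype.sum_prod_type, Finset.sum_comm,
    map_sum, Finset.mul_sum, ← Finset.sum_add_distrib]
  refine Finset.sum_congr rfl fun e _ => ?_
  rw [Fin.sum_univ_succ]
  congr 1
  · rw [Fin.prod_univ_succ]
    simp [wt_succ]
    congr 1
  · rw [deriv_prod d (x * y) _ _ (by intro i _; unfold wt; split_ifs <;> assumption)]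
    rw [← Equiv.sum_comp e]
    refine Finset.sum_congr rfl fun p _ => ?_
    rw [Fin.prod_univ_succ, ← Finset.mul_prod_erase univ _ (mem_univ p)]
    have h1 : ∀ i ∈ univ.erase p, wt x y s (i.succ : Fin (n+1))
        (Equiv.Perm.decomposeFin.symm ((e p).succ, e) i.succ : Fin (n+1)) =
        wt x y s i (e i) := by
      intro i hi
      have hi : i ≠ p := by simpa using hi
      rw [Equiv.Perm.decomposeFin_symm_apply_succ, Equiv.swap_apply_of_ne_of_ne
        (Fin.succ_ne_zero _) (by simpa using hi)]
      simp [wt_succ]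
    rw [Finset.prod_congr rfl h1]
    simp [wt]
    ring

def uu (x y s : R) (a b : ℕ) : R := if b < a then y else if b = a + 1 then s else x

theorem uu_succ (x y s : R) (i j : ℕ) : uu x y s (i + 1) (j + 1) = uu x y s i j := by
  simp [uu]

def WW (x y s : R) (n : ℕ) (f : ℕ → ℕ) : R := ∏ i ∈ range n, uu x y s (f i) (f (i + 1))

/-- insert a new minimum at position `k`. -/
def insf (k : ℕ) (f : ℕ → ℕ) (i : ℕ) : ℕ :=
  if i < k then f i + 1 else if i = k then 0 else f (i - 1) + 1

theorem WW_zero (x y s : R) (n : ℕ) (f : ℕ → ℕ) :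
    WW x y s (n + 1) (insf 0 f) = (x + if f 0 = 0 then s - x else 0) * WW x y s n f := by
  unfold WW
  rw [Finset.prod_range_succ', mul_comm]
  congr 1
  · by_cases h : f 0 = 0 <;> simp [insf, uu, h]
  · exact Finset.prod_congr rfl fun i _ => by simp [insf, uu_succ]

theorem WW_last (x y s : R) (n : ℕ) (f : ℕ → ℕ) :
    WW x y s (n + 1) (insf (n + 1) f) = y * WW x y s n f := by
  unfold WW
  rw [Finset.prod_range_succ, mul_comm]
  congr 1
  · simp [insf, uu]
  · refine Finset.prod_congr rfl fun i hi => ?_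
    have := mem_range.1 hi
    rw [insf, insf, if_pos (by omega), if_pos (by omega), uu_succ]

theorem prod_erase_mid (j m : ℕ) (g : ℕ → R) :
    ∏ i ∈ (range (j + 1 + m)).erase j, g i =
      (∏ i ∈ range j, g i) * ∏ i ∈ range m, g (j + 1 + i) := by
  have h : (range (j + 1 + m)).erase j = range j ∪ (range m).map (addLeftEmbedding (j + 1)) := by
    ext a
    simp only [mem_erase, mem_range, mem_union, mem_map, addLeftEmbedding_apply]
    constructor
    · rintro ⟨h1, h2⟩
      by_cases h : a < j
      · exact Or.inl h
      · exact Or.inr ⟨a - (j + 1), by omega, by omega⟩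
    · rintro (h | ⟨b, h1, h2⟩) <;> omega
  rw [h, Finset.prod_union, Finset.prod_map]
  · rfl
  · rw [Finset.disjoint_left]
    intro a ha hb
    simp only [mem_range, mem_map, addLeftEmbedding_apply] at ha hb
    obtain ⟨b, _, hb⟩ := hb
    omega

theorem WW_mid (x y s : R) (n j : ℕ) (hj : j < n) (f : ℕ → ℕ)
    (hf : f (j + 1) = 0 → f j ≠ 0) :
    WW x y s (n + 1) (insf (j + 1) f) =
      (∏ i ∈ (range n).erase j, uu x y s (f i) (f (i + 1))) * (x * y) +
      (if f (j + 1) = 0 then s - x else 0) * WW x y s n f := by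
  unfold WW
  rw [← Finset.mul_prod_erase (range n) _ (mem_range.2 hj)]
  obtain ⟨m, rfl⟩ := Nat.exists_eq_add_of_lt hj
  rw [show j + m + 1 = j + 1 + m by ring, prod_erase_mid, show j + 1 + m + 1 = j + 2 + m by ring,
    Finset.prod_range_add, Finset.prod_range_succ, Finset.prod_range_succ]
  have h1 : ∏ i ∈ range j, uu x y s (insf (j + 1) f i) (insf (j + 1) f (i + 1)) =
      ∏ i ∈ range j, uu x y s (f i) (f (i + 1)) := by
    refine Finset.prod_congr rfl fun i hi => ?_
    have := mem_range.1 hi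
    rw [insf, insf, if_pos (by omega), if_pos (by omega), uu_succ]
  have h2 : ∏ i ∈ range m, uu x y s (insf (j + 1) f (j + 2 + i)) (insf (j + 1) f (j + 2 + i + 1)) =
      ∏ i ∈ range m, uu x y s (f (j + 1 + i)) (f (j + 1 + i + 1)) := by
    refine Finset.prod_congr rfl fun i hi => ?_
    rw [insf, insf, if_neg (by omega), if_neg (by omega), if_neg (by omega), if_neg (by omega),
      uu_succ, show j + 2 + i - 1 = j + 1 + i by omega,
      show j + 2 + i + 1 - 1 = j + 1 + i + 1 by omega]
  have h3 : uu x y s (insf (j + 1) f j) (insf (j + 1) f (j + 1)) = y := by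
    simp [insf, uu]
  have h4 : uu x y s (insf (j + 1) f (j + 1)) (insf (j + 1) f (j + 1 + 1)) =
      x + if f (j + 1) = 0 then s - x else 0 := by
    by_cases h : f (j + 1) = 0 <;> simp [insf, uu, h]
  rw [h1, h2, h3, h4]
  by_cases h : f (j + 1) = 0
  · have h5 : uu x y s (f j) (f (j + 1)) = y := by
      have := hf h
      simp [uu, h]; omega
    rw [h5]; simp only [h, if_true]; ring
  · simp only [h, if_false]; ring

theorem WW_sum (d : Derivation ℤ R R) (x y s : R) (hx : d x = x * y) (hy : d y = x * y)
    (hs : d s = x * y) (n : ℕ) (f : ℕ → ℕ) (p : ℕ) (hp : p < n + 1)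
    (hf : ∀ i < n + 1, f i = 0 ↔ i = p) :
    ∑ k ∈ range (n + 2), WW x y s (n + 1) (insf k f) =
      (y + s) * WW x y s n f + d (WW x y s n f) := by
  have hd : d (WW x y s n f) = _ := deriv_prod d (x * y) _ _
    (by intro i _; unfold uu; split_ifs <;> assumption)
  have hc : ∑ k ∈ range (n + 1), (if f k = 0 then s - x else 0) = s - x := by
    rw [Finset.sum_eq_single p]
    · simp [(hf p hp).2 rfl]
    · intro b hb hbp
      simp [hf b (mem_range.1 hb), hbp]
    · intro h; simp at h; omega
  rw [Finset.sum_range_succ, WW_last, Finset.sum_range_succ', WW_zero,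
    Finset.sum_congr rfl fun j hj => WW_mid x y s n j (mem_range.1 hj) f ?_,
    Finset.sum_add_distrib, ← hd, ← Finset.sum_mul]
  · rw [Finset.sum_range_succ'] at hc
    linear_combination (WW x y s n f) * hc
  · have := mem_range.1 hj
    rw [Ne, hf (j + 1) (by omega), hf j (by omega)]
    omega

def fv {n : ℕ} (π : Equiv.Perm (Fin n)) (i : ℕ) : ℕ := if h : i < n then π ⟨i, h⟩ else 0

def Pp (n : ℕ) (x y s : R) : R := ∑ π : Equiv.Perm (Fin (n + 1)), WW x y s n (fv π)

def insP {n : ℕ} (k : Fin (n + 1)) (e : Equiv.Perm (Fin n)) : Equiv.Perm (Fin (n + 1)) :=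
  Equiv.Perm.decomposeFin.symm (0, e) * k.cycleRange

theorem insP_self {n : ℕ} (k : Fin (n + 1)) (e : Equiv.Perm (Fin n)) : insP k e k = 0 := by
  cases n with
  | zero => exact Fin.ext (by omega)
  | succ n => simp [insP]

theorem insP_succAbove {n : ℕ} (k : Fin (n + 1)) (e : Equiv.Perm (Fin n)) (j : Fin n) :
    insP k e (k.succAbove j) = (e j).succ := by
  simp [insP]

theorem insP_bij (n : ℕ) : Function.Bijective
    (fun p : Fin (n + 1) × Equiv.Perm (Fin n) => insP p.1 p.2) := by
  rw [Fintype.bijective_iff_injective_and_card]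
  constructor
  · rintro ⟨k, e⟩ ⟨k', e'⟩ h
    simp only at h
    have hk : k = k' := by
      apply (insP k e).injective
      rw [insP_self, h, insP_self]
    subst hk
    congr 1
    ext j
    have := congrArg (fun σ => ((σ (k.succAbove j) : Fin (n + 1)) : ℕ)) h
    simpa [insP_succAbove] using this
  · simp [Fintype.card_perm, Nat.factorial_succ]

theorem fv_insP {n : ℕ} (k : Fin (n + 1)) (e : Equiv.Perm (Fin n)) (i : ℕ) (hi : i < n + 1) :
    fv (insP k e) i = insf k (fv e) i := by
  rw [fv, dif_pos hi]
  rcases lt_trichotomy i (k : ℕ) with h | h | h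
  · have h1 : i < n := by omega
    have h2 : (⟨i, hi⟩ : Fin (n + 1)) = k.succAbove ⟨i, h1⟩ := by
      rw [Fin.succAbove_of_castSucc_lt]
      · rfl
      · exact h
    rw [h2, insP_succAbove, insf, if_pos h, fv, dif_pos h1]
    simp
  · have h2 : (⟨i, hi⟩ : Fin (n + 1)) = k := Fin.ext h
    rw [h2, insP_self, insf, if_neg (by omega), if_pos h]
    simp
  · have h1 : i - 1 < n := by omega
    have h2 : (⟨i, hi⟩ : Fin (n + 1)) = k.succAbove ⟨i - 1, h1⟩ := by
      rw [Fin.succAbove_of_le_castSucc]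
      · ext; simp; omega
      · rw [Fin.le_def]; simp; omega
    rw [h2, insP_succAbove, insf, if_neg (by omega), if_neg (by omega), fv, dif_pos h1]
    simp

theorem WW_congr (x y s : R) (n : ℕ) (f g : ℕ → ℕ) (h : ∀ i < n + 1, f i = g i) :
    WW x y s n f = WW x y s n g := by
  refine Finset.prod_congr rfl fun i hi => ?_
  have := mem_range.1 hi
  rw [h i (by omega), h (i + 1) (by omega)]

theorem Pp_succ (d : Derivation ℤ R R) (x y s : R) (hx : d x = x * y) (hy : d y = x * y)
    (hs : d s = x * y) (n : ℕ) :
    Pp (n + 1) x y s = (y + s) * Pp n x y s + d (Pp n x y s) := by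
  unfold Pp
  rw [← (insP_bij (n + 1)).sum_comp, Fintype.sum_prod_type, Finset.sum_comm,
    map_sum, Finset.mul_sum, ← Finset.sum_add_distrib]
  refine Finset.sum_congr rfl fun e _ => ?_
  rw [← WW_sum d x y s hx hy hs n (fv e) (e.symm 0) (e.symm 0).2, Finset.sum_range]
  · exact Finset.sum_congr rfl fun k _ => WW_congr _ _ _ _ _ _ fun i hi => fv_insP k e i hi
  · intro i hi
    rw [fv, dif_pos hi]
    have h0 : ((e ⟨i, hi⟩ : Fin (n + 1)) : ℕ) = 0 ↔ e ⟨i, hi⟩ = 0 := by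
      rw [Fin.ext_iff]; rfl
    rw [h0, ← Equiv.eq_symm_apply, Fin.ext_iff]

def Qp (n : ℕ) (x y s : R) : R :=
  ∑ ij ∈ antidiagonal n, (n.choose ij.1 : R) * (Dp ij.1 x y y * Dp ij.2 x y s)

theorem Qp_succ (d : Derivation ℤ R R) (x y s : R) (hx : d x = x * y) (hy : d y = x * y)
    (hs : d s = x * y) (n : ℕ) :
    Qp (n + 1) x y s = (y + s) * Qp n x y s + d (Qp n x y s) := by
  unfold Qp
  rw [Finset.sum_antidiagonal_choose_succ_mul (fun i j => Dp i x y y * Dp j x y s),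
    map_sum, Finset.mul_sum, ← Finset.sum_add_distrib, ← Finset.sum_add_distrib]
  refine Finset.sum_congr rfl fun ij hij => ?_
  have hc : n.choose ij.2 = n.choose ij.1 :=
    Nat.choose_symm_of_eq_add (by rw [← mem_antidiagonal.1 hij, add_comm])
  rw [hc, Dp_succ d x y s hx hy hs, Dp_succ d x y y hx hy hy, Derivation.leibniz,
    Derivation.leibniz, Derivation.map_natCast]
  simp only [smul_eq_mul]
  ring

theorem Pp_eq_Qp (d : Derivation ℤ R R) (x y s : R) (hx : d x = x * y) (hy : d y = x * y)
    (hs : d s = x * y) (n : ℕ) : Pp n x y s = Qp n x y s := by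
  induction n with
  | zero => simp [Pp, Qp, Dp, WW]
  | succ n ih => rw [Pp_succ d x y s hx hy hs, Qp_succ d x y s hx hy hs, ih]

theorem map_Dp {S : Type*} [CommRing S] (φ : R →+* S) (n : ℕ) (x y s : R) :
    φ (Dp n x y s) = Dp n (φ x) (φ y) (φ s) := by
  simp only [Dp, wt, map_sum, map_prod, apply_ite φ]

theorem map_Pp {S : Type*} [CommRing S] (φ : R →+* S) (n : ℕ) (x y s : R) :
    φ (Pp n x y s) = Pp n (φ x) (φ y) (φ s) := by
  simp only [Pp, WW, uu, map_sum, map_prod, apply_ite φ]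

theorem map_Qp {S : Type*} [CommRing S] (φ : R →+* S) (n : ℕ) (x y s : R) :
    φ (Qp n x y s) = Qp n (φ x) (φ y) (φ s) := by
  simp only [Qp, map_sum, map_mul, map_natCast, map_Dp]

theorem Pp_eq_Qp_all (n : ℕ) (x y s : R) : Pp n x y s = Qp n x y s := by
  let φ : MvPolynomial (Fin 3) ℤ →+* R := MvPolynomial.eval₂Hom (Int.castRingHom R) ![x, y, s]
  let d : Derivation ℤ (MvPolynomial (Fin 3) ℤ) (MvPolynomial (Fin 3) ℤ) :=
    MvPolynomial.mkDerivation ℤ (fun _ => MvPolynomial.X 0 * MvPolynomial.X 1)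
  have h := congrArg φ (Pp_eq_Qp d (MvPolynomial.X 0) (MvPolynomial.X 1) (MvPolynomial.X 2)
    (MvPolynomial.mkDerivation_X _ _ _) (MvPolynomial.mkDerivation_X _ _ _)
    (MvPolynomial.mkDerivation_X _ _ _) n)
  rw [map_Pp, map_Qp] at h
  simpa [φ] using h

theorem WW_eq (n : ℕ) (x y s : R) (π : Equiv.Perm (Fin (n + 1))) :
    x ^ basc π * y ^ des π * s ^ suc π = WW x y s n (fv π) := by
  unfold basc des suc WW
  simp only [← Finset.prod_const, Finset.prod_filter, ← Finset.prod_mul_distrib]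
  refine Finset.prod_nbij' (fun i => i - 1) (fun i => i + 1) ?_ ?_ ?_ ?_ ?_
  · intro i hi; simp only [mem_Icc, mem_range] at *; omega
  · intro i hi; simp only [mem_Icc, mem_range] at *; omega
  · intro i hi; simp only [mem_Icc] at *; omega
  · intro i hi; simp only [mem_range] at *; omega
  · intro i hi
    rw [mem_Icc] at hi
    obtain ⟨j, rfl⟩ : ∃ j, i = j + 1 := ⟨i - 1, by omega⟩
    have hj : j < n := by omega
    have w1 : word π (j + 1) = fv π j + 1 := by
      rw [word, dif_pos (by omega), fv, dif_pos (by omega)]; rfl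
    have w2 : word π (j + 1 + 1) = fv π (j + 1) + 1 := by
      rw [word, dif_pos (by omega), fv, dif_pos (by omega)]; rfl
    have hne : fv π j ≠ fv π (j + 1) := by
      rw [fv, dif_pos (by omega), fv, dif_pos (by omega), Ne, Fin.val_inj, π.injective.eq_iff]
      simp
    rw [w1, w2, Nat.add_sub_cancel, uu]
    generalize fv π j = a at *
    generalize fv π (j + 1) = b at *
    rcases lt_trichotomy b (a + 1) with h | h | h
    · rw [if_neg (by omega), if_pos (by omega), if_neg (by omega), if_pos (by omega)]; ring
    · rw [if_neg (by omega), if_neg (by omega), if_pos (by omega), if_neg (by omega),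
        if_pos (by omega)]; ring
    · rw [if_pos (by omega), if_neg (by omega), if_neg (by omega), if_neg (by omega),
        if_neg (by omega)]; ring

theorem Dp_eq (n : ℕ) (x y s : R) :
    ∑ σ : Equiv.Perm (Fin n), x ^ excStat σ * y ^ dropStat σ * s ^ fixStat σ = Dp n x y s := by
  unfold Dp
  refine Finset.sum_congr rfl fun σ _ => ?_
  unfold excStat dropStat fixStat
  simp only [← Finset.prod_const, Finset.prod_filter, ← Finset.prod_mul_distrib]
  refine Finset.prod_congr rfl fun i _ => ?_
  unfold wt
  simp only [Fin.lt_def, Fin.ext_iff]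
  generalize (σ i : ℕ) = a
  generalize (i : ℕ) = b
  rcases lt_trichotomy a b with h | h | h
  · rw [if_neg (by omega), if_pos (by omega), if_neg (by omega), if_neg (by omega),
      if_pos (by omega)]; ring
  · rw [if_neg (by omega), if_neg (by omega), if_pos (by omega), if_neg (by omega),
      if_neg (by omega)]; ring
  · rw [if_pos (by omega), if_neg (by omega), if_neg (by omega), if_pos (by omega)]; ring

end Aux

/-- `Σ_{π ∈ S_{n+1}} x^basc y^des s^suc
= Σ_{i=0}^n C(n,i) (Σ_{σ ∈ S_i} x^exc y^(drop+fix)) (Σ_{τ ∈ S_{n-i}} x^exc y^drop s^fix)`. -/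
theorem statement10 (n : ℕ) (x y s : ℝ) :
    ∑ π : Equiv.Perm (Fin (n + 1)), x ^ basc π * y ^ des π * s ^ suc π =
      ∑ i ∈ Finset.range (n + 1),
        (n.choose i : ℝ) *
          (∑ σ : Equiv.Perm (Fin i), x ^ excStat σ * y ^ (dropStat σ + fixStat σ)) *
          ∑ τ : Equiv.Perm (Fin (n - i)), x ^ excStat τ * y ^ dropStat τ * s ^ fixStat τ := by
  simp only [WW_eq, pow_add, ← mul_assoc, Dp_eq]
  refine (Pp_eq_Qp_all n x y s).trans ?_
  rw [Qp, Finset.Nat.sum_antidiagonal_eq_sum_range_succ_mk]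
  simp only [mul_assoc]

end SucEuler
end

section
/- For every n ≥ 1 and all subsets S, T of [n]: the number of permutations π ∈ S_n with Suc*(π)=S and Plrmin(π)=T equals the number of permutations π ∈ S_n with Suc*(π)=T and Plrmin(π)=S. That is, the pair of set-valued statistics (Suc*, Plrmin) is symmetric over S_n. -/
open Finset

namespace SucEuler

open Classical in
/-- the value `v` is a left-to-right minimum value of `π` -/
noncomputable def IsLRMinValue {n : ℕ} (π : Equiv.Perm (Fin n)) (v : ℕ) : Prop :=
  ∃ j ∈ Finset.Icc 1 n, word π j = v ∧ ∀ l ∈ Finset.Icc 1 n, l < j → v < word π l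

open Classical in
/-- `Suc*(π) = {π(i) : i ∈ [n-1], π(i+1) = π(i)+1}`, the set of succession values -/
noncomputable def sucStarSet {n : ℕ} (π : Equiv.Perm (Fin n)) : Finset ℕ :=
  ((Finset.Icc 1 (n - 1)).filter fun i => word π (i + 1) = word π i + 1).image (word π)

open Classical in
/-- `Plrmin(π) = {π(i) : i ∈ [n], π(i) > π(i+1), π(i) ≠ n, π(i)+1 is a left-to-right
minimum}`, with the convention `π(n+1) = 0` -/
noncomputable def plrminSet {n : ℕ} (π : Equiv.Perm (Fin n)) : Finset ℕ :=
  ((Finset.Icc 1 n).filter fun i =>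
    word π (i + 1) < word π i ∧ word π i ≠ n ∧ IsLRMinValue π (word π i + 1)).image (word π)


/-- position of a value -/
def posn {n : ℕ} (π : Equiv.Perm (Fin n)) (v : ℕ) : ℕ :=
  if h : 1 ≤ v ∧ v ≤ n then ((π.symm ⟨v - 1, by omega⟩ : Fin n) : ℕ) + 1 else 0

lemma posn_le {n : ℕ} (π : Equiv.Perm (Fin n)) (i : ℕ) : posn π i ≤ n := by
  unfold posn; split_ifs with h
  · have := (π.symm ⟨i - 1, by omega⟩).isLt
    omega
  · omega

lemma posn_zero {n : ℕ} (π : Equiv.Perm (Fin n)) : posn π 0 = 0 := by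
  simp [posn]

lemma word_posn {n : ℕ} (π : Equiv.Perm (Fin n)) {v : ℕ} (hv : v ≤ n) :
    word π (posn π v) = v := by
  by_cases h : 1 ≤ v
  · have h1 : posn π v = ((π.symm ⟨v - 1, by omega⟩ : Fin n) : ℕ) + 1 := by
      simp [posn, h, hv]
    have h2 := (π.symm ⟨v - 1, by omega⟩).isLt
    rw [h1]
    unfold word
    rw [dif_pos (by omega)]
    simp
    omega
  · have : v = 0 := by omega
    subst this
    rw [posn_zero, word_zero]

lemma posn_word {n : ℕ} (π : Equiv.Perm (Fin n)) {v : ℕ} (hv : v ≤ n) :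
    posn π (word π v) = v := by
  by_cases h : 1 ≤ v
  · have h1 : word π v = ((π ⟨v - 1, by omega⟩ : Fin n) : ℕ) + 1 := by
      simp [word, h, hv]
    have h2 := (π ⟨v - 1, by omega⟩).isLt
    rw [h1]
    unfold posn
    rw [dif_pos (by omega)]
    simp
    omega
  · have : v = 0 := by omega
    subst this
    rw [word_zero, posn_zero]

lemma posn_pos {n : ℕ} (π : Equiv.Perm (Fin n)) {v : ℕ} (h1 : 1 ≤ v) (hv : v ≤ n) :
    1 ≤ posn π v := by
  unfold posn
  rw [dif_pos ⟨h1, hv⟩]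
  omega

lemma posn_inj {n : ℕ} (π : Equiv.Perm (Fin n)) {u v : ℕ} (hu : u ≤ n) (hv : v ≤ n)
    (h : posn π u = posn π v) : u = v := by
  rw [← word_posn π hu, ← word_posn π hv, h]

/-- nearest smaller value to the left -/
def nsl {n : ℕ} (π : Equiv.Perm (Fin n)) (w : ℕ) : ℕ :=
  word π (Nat.findGreatest (fun k => word π k < w) (posn π w - 1))

lemma nsl_spec {n : ℕ} (π : Equiv.Perm (Fin n)) {w : ℕ} (h1 : 1 ≤ w) (hw : w ≤ n) :
    nsl π w < w ∧ posn π (nsl π w) < posn π w ∧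
      ∀ l, posn π (nsl π w) < l → l < posn π w → w < word π l := by
  have hp := posn_pos π h1 hw
  have hpn := posn_le π w
  have hle := Nat.findGreatest_le (P := fun k => word π k < w) (posn π w - 1)
  have hs : word π (Nat.findGreatest (fun k => word π k < w) (posn π w - 1)) < w :=
    Nat.findGreatest_spec (P := fun k => word π k < w) (m := 0) (Nat.zero_le _)
      (by rw [word_zero]; omega)
  have hpos : posn π (nsl π w) = Nat.findGreatest (fun k => word π k < w) (posn π w - 1) :=
    posn_word π (by omega)
  refine ⟨hs, by omega, ?_⟩
  intro l hl1 hl2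
  rw [hpos] at hl1
  have := Nat.findGreatest_is_greatest hl1 (by omega)
  rcases Nat.lt_trichotomy (word π l) w with h | h | h
  · exact absurd h this
  · have hq := posn_word π (show l ≤ n by omega)
    rw [h] at hq
    omega
  · exact h

lemma nsl_unique {n : ℕ} (π : Equiv.Perm (Fin n)) {w u : ℕ} (h1 : 1 ≤ w) (hw : w ≤ n)
    (hu : u < w) (hp : posn π u < posn π w)
    (hb : ∀ l, posn π u < l → l < posn π w → w < word π l) : nsl π w = u := by
  obtain ⟨a, b, c⟩ := nsl_spec π h1 hw
  apply posn_inj π (by omega) (by omega)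
  rcases Nat.lt_trichotomy (posn π (nsl π w)) (posn π u) with h | h | h
  · have := c _ h hp
    rw [word_posn π (by omega)] at this
    omega
  · exact h
  · have := hb _ h b
    rw [word_posn π (by omega)] at this
    omega

lemma posn_lt_iff {n : ℕ} (π : Equiv.Perm (Fin n)) {w u : ℕ} (hw : w ≤ n)
    (hu : u < w) : posn π u < posn π w ↔ u = nsl π w ∨ posn π u < posn π (nsl π w) := by
  obtain ⟨a, b, c⟩ := nsl_spec π (by omega : 1 ≤ w) hw
  constructor
  · intro h
    by_contra! hcon
    have hne : posn π u ≠ posn π (nsl π w) := fun e =>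
      hcon.1 (posn_inj π (by omega) (by omega) e)
    have := c (posn π u) (by omega) h
    rw [word_posn π (by omega)] at this
    omega
  · rintro (h | h)
    · rw [h]; exact b
    · omega

lemma order_eq {n : ℕ} (π σ : Equiv.Perm (Fin n))
    (h : ∀ w, 1 ≤ w → w ≤ n → nsl π w = nsl σ w) :
    ∀ w, w ≤ n → ∀ u, u < w → (posn π u < posn π w ↔ posn σ u < posn σ w) := by
  intro w
  induction w using Nat.strong_induction_on with
  | _ w ih =>
    intro hw u hu
    rw [posn_lt_iff π hw hu, posn_lt_iff σ hw hu, ← h w (by omega) hw]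
    have ha := (nsl_spec π (by omega : 1 ≤ w) hw).1
    set a := nsl π w
    rcases Nat.lt_trichotomy u a with hl | hl | hl
    · rw [ih a ha (by omega) u hl]
    · simp [hl]
    · have h1 := ih u hu (by omega) a hl
      have hne1 : posn π u ≠ posn π a := fun e => by
        have := posn_inj π (by omega) (by omega) e
        omega
      have hne2 : posn σ u ≠ posn σ a := fun e => by
        have := posn_inj σ (by omega) (by omega) e
        omega
      omega

lemma posn_fin {n : ℕ} (π : Equiv.Perm (Fin n)) (i : Fin n) :
    posn π (i + 1) = (π.symm i : ℕ) + 1 := by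
  have := i.isLt
  unfold posn
  rw [dif_pos (by omega)]
  simp

/-- codes -/
abbrev Code (n : ℕ) := (i : Fin n) → Fin ((i : ℕ) + 1)

/-- code of a permutation -/
def toCode {n : ℕ} (π : Equiv.Perm (Fin n)) : Code n := fun i =>
  ⟨nsl π (i + 1), (nsl_spec π (by omega) i.isLt).1⟩

lemma toCode_inj {n : ℕ} : Function.Injective (toCode (n := n)) := by
  intro π σ h
  have hn : ∀ w, 1 ≤ w → w ≤ n → nsl π w = nsl σ w := by
    intro w h1 hw
    have := congrArg Fin.val (congrFun h ⟨w - 1, by omega⟩)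
    simp only [toCode] at this
    rwa [Nat.sub_add_cancel h1] at this
  have ho := order_eq π σ hn
  have key : ∀ i j : Fin n, π.symm i < π.symm j → σ.symm i < σ.symm j := by
    intro i j hij
    have hij' : (π.symm i : ℕ) < π.symm j := hij
    have hi := i.isLt
    have hj := j.isLt
    rcases Nat.lt_trichotomy (i : ℕ) j with hl | hl | hl
    · have := ho (j + 1) (by omega) (i + 1) (by omega)
      simp only [posn_fin] at this
      exact Fin.lt_def.2 (by omega)
    · rw [Fin.ext hl] at hij
      exact absurd hij (lt_irrefl _)
    · have := ho (i + 1) (by omega) (j + 1) (by omega)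
      simp only [posn_fin] at this
      have hne : (σ.symm i : ℕ) ≠ σ.symm j := fun e => by
        have := σ.symm.injective (Fin.ext e)
        rw [this] at hl
        omega
      exact Fin.lt_def.2 (by omega)
  have hm : StrictMono (fun k => σ.symm (π k)) := by
    intro a b hab
    apply key
    simpa using hab
  have hid : (fun k => σ.symm (π k)) = id := by
    have : Set.range (fun k => σ.symm (π k)) = Set.range (id : Fin n → Fin n) := by
      rw [Set.range_id]
      exact (σ.symm.surjective.comp π.surjective).range_eq
    exact (StrictMono.range_inj hm strictMono_id).1 this
  ext k
  have := congrFun hid k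
  simp only [id] at this
  rw [Equiv.symm_apply_eq] at this
  rw [this]

lemma card_code (n : ℕ) : Fintype.card (Code n) = n.factorial := by
  rw [Fintype.card_pi]
  simp only [Fintype.card_fin]
  rw [Fin.prod_univ_eq_prod_range (fun i => i + 1) n, Finset.prod_range_add_one_eq_factorial]

lemma toCode_bij {n : ℕ} : Function.Bijective (toCode (n := n)) := by
  rw [Fintype.bijective_iff_injective_and_card]
  refine ⟨toCode_inj, ?_⟩
  rw [card_code, Fintype.card_perm, Fintype.card_fin]

/-- `i` is free: never used as code by an entry after index `i` -/
def Free {n : ℕ} (c : Code n) (i : ℕ) : Prop := ∀ j : Fin n, i < j → (c j : ℕ) ≠ i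

open Classical in
/-- swap map -/
noncomputable def swp {n : ℕ} (c : Code n) : Code n := fun i =>
  if Free c i ∧ (c i : ℕ) = i then ⟨0, by omega⟩
  else if Free c i ∧ (c i : ℕ) = 0 then Fin.last _ else c i

lemma swp_ne {n : ℕ} (c : Code n) (j : Fin n) (v : ℕ) (h1 : 1 ≤ v) (hv : v < j) :
    (swp c j : ℕ) = v ↔ (c j : ℕ) = v := by
  unfold swp
  split_ifs with h h'
  · simp; omega
  · simp; omega
  · rfl

lemma free_swp {n : ℕ} (c : Code n) (v : ℕ) (h1 : 1 ≤ v) : Free (swp c) v ↔ Free c v := by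
  unfold Free
  refine forall_congr' fun j => forall_congr' fun hj => not_congr ?_
  exact swp_ne c j v h1 hj

lemma swp_last {n : ℕ} (c : Code n) (i : Fin n) (h1 : 1 ≤ (i : ℕ)) :
    (Free (swp c) i ∧ (swp c i : ℕ) = i) ↔ (Free c i ∧ (c i : ℕ) = 0) := by
  rw [free_swp c i h1]
  refine and_congr_right fun hf => ?_
  unfold swp
  split_ifs with h h'
  · dsimp only; omega
  · exact iff_of_true (Fin.val_last _) h'.2
  · constructor <;> intro h'' <;> tauto

lemma swp_first {n : ℕ} (c : Code n) (i : Fin n) (h1 : 1 ≤ (i : ℕ)) :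
    (Free (swp c) i ∧ (swp c i : ℕ) = 0) ↔ (Free c i ∧ (c i : ℕ) = i) := by
  rw [free_swp c i h1]
  refine and_congr_right fun hf => ?_
  unfold swp
  split_ifs with h h'
  · dsimp only; omega
  · simp only [Fin.val_last]; omega
  · constructor <;> intro h'' <;> tauto

lemma swp_swp {n : ℕ} (c : Code n) : swp (swp c) = c := by
  funext i
  by_cases h1 : 1 ≤ (i : ℕ)
  · have a := swp_last c i h1
    have b := swp_first c i h1
    apply Fin.ext
    by_cases hl : Free c i ∧ (c i : ℕ) = i
    · have hs : (swp c i : ℕ) = 0 := (b.2 hl).2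
      have hs2 := (swp_last (swp c) i h1).2 (b.2 hl)
      rw [hs2.2, hl.2]
    · by_cases hz : Free c i ∧ (c i : ℕ) = 0
      · have hs2 := (swp_first (swp c) i h1).2 (a.2 hz)
        rw [hs2.2, hz.2]
      · have e1 : swp c i = c i := by
          unfold swp
          rw [if_neg hl, if_neg hz]
        have e2 : swp (swp c) i = swp c i := by
          generalize swp c = d at a b
          unfold swp
          rw [if_neg (by rw [a]; exact hz), if_neg (by rw [b]; exact hl)]
        rw [e2, e1]
  · apply Fin.ext
    have := (swp (swp c) i).isLt
    have := (c i).isLt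
    omega

lemma free_iff {n : ℕ} (π : Equiv.Perm (Fin n)) (v : ℕ) :
    Free (toCode π) v ↔ ∀ w, v + 1 < w → w ≤ n → nsl π w ≠ v := by
  constructor
  · intro h w hw hwn
    have := h ⟨w - 1, by omega⟩ (by simp; omega)
    simp only [toCode] at this
    rwa [Nat.sub_add_cancel (by omega)] at this
  · intro h j hj
    exact h (j + 1) (by omega) (by omega)

/-- if `w` immediately follows the smaller `v`, then `nsl w = v` -/
lemma nsl_next {n : ℕ} (π : Equiv.Perm (Fin n)) {v : ℕ} (hv : v ≤ n)
    (hlt : v < word π (posn π v + 1)) : nsl π (word π (posn π v + 1)) = v := by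
  have hle := word_le π (posn π v + 1)
  have hp : posn π v + 1 ≤ n := by
    by_contra hcon
    have : word π (posn π v + 1) = 0 := by
      unfold word; rw [dif_neg (by omega)]
    omega
  have := posn_word π hp
  apply nsl_unique π (by omega) hle hlt (by omega)
  intro l h1 h2
  omega

lemma next_of_nsl {n : ℕ} (π : Equiv.Perm (Fin n)) {w v : ℕ} (h1 : 1 ≤ w) (hw : w ≤ n)
    (h : nsl π w = v) : w ≤ word π (posn π v + 1) := by
  obtain ⟨a, b, c⟩ := nsl_spec π h1 hw
  rw [h] at a b c
  by_cases e : posn π v + 1 = posn π w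
  · rw [e, word_posn π hw]
  · exact (c _ (by omega) (by omega)).le

lemma mem_suc {n : ℕ} (π : Equiv.Perm (Fin n)) (v : ℕ) :
    v ∈ sucStarSet π ↔ ∃ i : Fin n, (i : ℕ) = v ∧ 1 ≤ (i : ℕ) ∧
      Free (toCode π) i ∧ (toCode π i : ℕ) = i := by
  unfold sucStarSet
  simp only [mem_image, mem_filter, mem_Icc]
  constructor
  · rintro ⟨i, ⟨⟨h1, h2⟩, h3⟩, rfl⟩
    have hpi := posn_word π (show i ≤ n by omega)
    have hle := word_le π (i + 1)
    have hwl := word_le π i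
    have hpos : 1 ≤ word π i := by
      by_contra hcon
      have : word π i = 0 := by omega
      rw [this, posn_zero] at hpi
      omega
    refine ⟨⟨word π i, by omega⟩, rfl, hpos, ?_, ?_⟩
    · rw [free_iff]
      intro w hw hwn hc
      have := next_of_nsl π (by omega) hwn hc
      simp only [hpi] at this hw
      omega
    · have := nsl_next π hwl (by rw [hpi]; omega)
      rw [hpi, h3] at this
      exact this
  · rintro ⟨i, rfl, h1, h2, h3⟩
    have hi := i.isLt
    rw [free_iff] at h2
    have h3 : nsl π (i + 1) = i := h3
    have hp := posn_pos π h1 (by omega)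
    have hx := next_of_nsl π (by omega) (by omega) h3
    have hy := nsl_next π (v := i) (by omega) (by omega)
    have hle := word_le π (posn π i + 1)
    have heq : word π (posn π i + 1) = i + 1 := by
      by_contra hcon
      exact h2 _ (by omega) hle hy
    have hpn : posn π i + 1 ≤ n := by
      by_contra hcon
      have : word π (posn π i + 1) = 0 := by
        unfold word; rw [dif_neg (by omega)]
      omega
    have hwp := word_posn π (show (i : ℕ) ≤ n by omega)
    exact ⟨posn π i, ⟨⟨hp, by omega⟩, by rw [hwp, heq]⟩, hwp⟩

lemma lrmin_iff {n : ℕ} (π : Equiv.Perm (Fin n)) {w : ℕ} (h1 : 1 ≤ w) (hw : w ≤ n) :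
    IsLRMinValue π w ↔ nsl π w = 0 := by
  unfold IsLRMinValue
  have hp := posn_pos π h1 hw
  have hpn := posn_le π w
  constructor
  · rintro ⟨j, hj, rfl, h⟩
    rw [mem_Icc] at hj
    have hpj := posn_word π hj.2
    apply nsl_unique π h1 hw (by omega)
    · rw [posn_zero]; omega
    · intro l hl1 hl2
      rw [posn_zero] at hl1
      exact h l (by rw [mem_Icc]; omega) (by omega)
  · intro h
    obtain ⟨a, b, c⟩ := nsl_spec π h1 hw
    rw [h, posn_zero] at c
    refine ⟨posn π w, by rw [mem_Icc]; omega, word_posn π hw, ?_⟩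
    intro l hl hlt
    rw [mem_Icc] at hl
    exact c l (by omega) hlt

lemma mem_plr {n : ℕ} (π : Equiv.Perm (Fin n)) (v : ℕ) :
    v ∈ plrminSet π ↔ ∃ i : Fin n, (i : ℕ) = v ∧ 1 ≤ (i : ℕ) ∧
      Free (toCode π) i ∧ (toCode π i : ℕ) = 0 := by
  unfold plrminSet
  simp only [mem_image, mem_filter, mem_Icc]
  constructor
  · rintro ⟨i, ⟨⟨h1, h2⟩, h3, h4, h5⟩, rfl⟩
    have hpi := posn_word π (show i ≤ n by omega)
    have hwl := word_le π i
    rw [lrmin_iff π (by omega) (by omega)] at h5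
    refine ⟨⟨word π i, by omega⟩, rfl, by simp only; omega, ?_, h5⟩
    rw [free_iff]
    intro w hw hwn hc
    have := next_of_nsl π (by omega) hwn hc
    simp only [hpi] at this hw
    omega
  · rintro ⟨i, rfl, h1, h2, h3⟩
    have hi := i.isLt
    rw [free_iff] at h2
    have h3 : nsl π (i + 1) = 0 := h3
    have hp := posn_pos π h1 (by omega)
    have hpn := posn_le π i
    have hle := word_le π (posn π i + 1)
    have hwp := word_posn π (show (i : ℕ) ≤ n by omega)
    refine ⟨posn π i, ⟨⟨hp, hpn⟩, ?_, by omega, ?_⟩, hwp⟩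
    · rw [hwp]
      by_contra hcon
      have hne : word π (posn π i + 1) ≠ i := by
        intro e
        by_cases hq : posn π i + 1 ≤ n
        · have := posn_word π hq
          rw [e] at this
          omega
        · have : word π (posn π i + 1) = 0 := by
            unfold word; rw [dif_neg (by omega)]
          omega
      have hy := nsl_next π (v := i) (by omega) (by omega)
      by_cases he : word π (posn π i + 1) = i + 1
      · rw [he] at hy
        omega
      · exact h2 _ (by omega) hle hy
    · rw [hwp, lrmin_iff π (by omega) (by omega)]
      exact h3

/-- the involution on permutations -/
noncomputable def inv {n : ℕ} (π : Equiv.Perm (Fin n)) : Equiv.Perm (Fin n) :=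
  (Equiv.ofBijective _ toCode_bij).symm (swp (toCode π))

lemma toCode_inv {n : ℕ} (π : Equiv.Perm (Fin n)) : toCode (inv π) = swp (toCode π) :=
  (Equiv.ofBijective _ toCode_bij).apply_symm_apply (swp (toCode π))

lemma inv_inv' {n : ℕ} (π : Equiv.Perm (Fin n)) : inv (inv π) = π := by
  apply toCode_inj
  rw [toCode_inv, toCode_inv, swp_swp]

lemma suc_inv {n : ℕ} (π : Equiv.Perm (Fin n)) : sucStarSet (inv π) = plrminSet π := by
  ext v
  rw [mem_suc, mem_plr, toCode_inv]
  refine exists_congr fun i => and_congr_right fun _ => and_congr_right fun h => ?_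
  exact swp_last _ i h

lemma plr_inv {n : ℕ} (π : Equiv.Perm (Fin n)) : plrminSet (inv π) = sucStarSet π := by
  rw [← suc_inv, inv_inv']

open Classical in
/-- the pair of set-valued statistics `(Suc*, Plrmin)` is symmetric over
`S_n`. -/
theorem statement12 (n : ℕ) (hn : 1 ≤ n) (S T : Finset ℕ)
    (hS : S ⊆ Finset.Icc 1 n) (hT : T ⊆ Finset.Icc 1 n) :
    (Finset.univ.filter fun π : Equiv.Perm (Fin n) =>
        sucStarSet π = S ∧ plrminSet π = T).card =
      (Finset.univ.filter fun π : Equiv.Perm (Fin n) =>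
        sucStarSet π = T ∧ plrminSet π = S).card := by
  refine Finset.card_nbij' inv inv ?_ ?_ (fun π _ => inv_inv' π) (fun π _ => inv_inv' π)
  · intro π h
    simp only [Finset.coe_filter, Finset.mem_univ, true_and, Set.mem_ofPred_eq] at h ⊢
    rw [suc_inv, plr_inv]
    exact ⟨h.2, h.1⟩
  · intro π h
    simp only [Finset.coe_filter, Finset.mem_univ, true_and, Set.mem_ofPred_eq] at h ⊢
    rw [suc_inv, plr_inv]
    exact ⟨h.2, h.1⟩

end SucEuler
end
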